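/- Let f be a homeomorphism of a compact metric space (X,d). If hpol(f) < 1, then for every ε > 0 there exists an integer k ≥ 1 such that for every x ∈ X there is a time j with 1 ≤ j ≤ k and d(x, f^j(x)) ≤ ε. In particular, every point of X is recurrent and no point is wandering. -/

import Mathlib

open Filter Topology Metric
open scoped ENNReal

variable {X : Type*}

/-- Minimal number of balls of radius `ε` for the Bowen metric
`d_n^f(x,y) = max_{0 ≤ j ≤ n-1} dist (f^[j] x) (f^[j] y)` needed to cover `X`. -/
noncomputable def covNum [PseudoMetricSpace X] (f : X → X) (ε : ℝ) (n : ℕ) : ℕ :=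
  sInf {m : ℕ | ∃ S : Finset X, S.card = m ∧
    ∀ x : X, ∃ s ∈ S, ∀ j < n, dist (f^[j] x) (f^[j] s) < ε}

/-- The polynomial entropy `hpol f = lim_{ε → 0} limsup_n log (Cov_ε(n)) / log n`,
with values in `[0,+∞]`.  Since `ε ↦ limsup_n log (Cov_ε(n)) / log n` is antitone,
the limit as `ε → 0` is the supremum over `ε > 0`. -/
noncomputable def hpol [PseudoMetricSpace X] (f : X → X) : ℝ≥0∞ :=
  ⨆ (ε : ℝ) (_ : 0 < ε),
    Filter.atTop.limsup fun n : ℕ =>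
      ENNReal.ofReal (Real.log (covNum f ε n) / Real.log n)

theorem covNum_set_nonempty [PseudoMetricSpace X] [CompactSpace X] (f : X → X)
    (hf : Continuous f) (ε : ℝ) (hε : 0 < ε) (n : ℕ) :
    ∃ S : Finset X, ∀ x : X, ∃ s ∈ S, ∀ j < n, dist (f^[j] x) (f^[j] s) < ε := by
  have ho : ∀ s : X, IsOpen {x : X | ∀ j < n, dist (f^[j] x) (f^[j] s) < ε} := by
    intro s
    have : {x : X | ∀ j < n, dist (f^[j] x) (f^[j] s) < ε}
        = ⋂ j ∈ Set.Iio n, {x : X | dist (f^[j] x) (f^[j] s) < ε} := by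
      ext x; simp
    rw [this]
    exact (Set.finite_Iio n).isOpen_biInter fun j _ =>
      isOpen_lt ((hf.iterate j).dist continuous_const) continuous_const
  obtain ⟨S, hS⟩ := isCompact_univ.elim_finite_subcover _ ho (by
    intro x _
    exact Set.mem_iUnion.2 ⟨x, by intro j _; simpa using hε⟩)
  refine ⟨S, fun x => ?_⟩
  have := hS (Set.mem_univ x)
  simp only [Set.mem_iUnion] at this
  obtain ⟨s, hs, h⟩ := this
  exact ⟨s, hs, h⟩

theorem iterate_symm_aux [TopologicalSpace X] (f : X ≃ₜ X) (x : X) (i m : ℕ) :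
    (⇑f)^[m + i] ((⇑f.symm)^[i] x) = (⇑f)^[m] x := by
  rw [Function.iterate_add_apply]
  congr 1
  exact (Function.LeftInverse.iterate (f.apply_symm_apply) i) x

theorem le_covNum [PseudoMetricSpace X] [CompactSpace X] (f : X ≃ₜ X) (ε : ℝ) (hε : 0 < ε)
    (n : ℕ) (x : X) (hx : ∀ j, 1 ≤ j → j ≤ n → ε < dist x ((⇑f)^[j] x)) :
    n ≤ covNum (⇑f) (ε / 2) n := by
  obtain ⟨S₀, hS₀⟩ := covNum_set_nonempty (⇑f) f.continuous (ε / 2) (by linarith) n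
  unfold covNum
  refine le_csInf ⟨_, S₀, rfl, hS₀⟩ ?_
  rintro m ⟨S, rfl, hS⟩
  choose g hg hg2 using fun i : ℕ => hS ((⇑f.symm)^[i] x)
  have key : ∀ i l, i < l → l < n → g i ≠ g l := by
    intro i l hil hl he
    have h1 := hg2 i l hl
    have h2 := hg2 l l hl
    obtain ⟨m, rfl⟩ : ∃ m, l = m + i := ⟨l - i, by omega⟩
    rw [iterate_symm_aux, he] at h1
    have h3 := iterate_symm_aux f x (m + i) 0
    rw [zero_add] at h3
    rw [h3] at h2
    have h4 := hx m (by omega) (by omega)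
    simp only [Function.iterate_zero, id] at h2
    have h5 := dist_triangle_right x ((⇑f)^[m] x) ((⇑f)^[m + i] (g (m + i)))
    linarith
  have := Finset.card_le_card_of_injOn (s := Finset.range n) (t := S) g
    (fun i _ => hg i) (by
      intro a ha b hb hab
      simp only [Finset.coe_range, Set.mem_Iio] at ha hb
      rcases lt_trichotomy a b with h | h | h
      · exact absurd hab (key a b h hb)
      · exact h
      · exact absurd hab.symm (key b a h ha))
  simpa using this

/-- If a homeomorphism `f` of a compact metric space satisfies `hpol f < 1`, then for
every `ε > 0` there is `k ≥ 1` such that every `x ∈ X` returns `ε`-close to itself at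
some time `j` with `1 ≤ j ≤ k`.  In particular every point of `X` is recurrent (and no
point is wandering). -/
theorem uniform_recurrence_of_hpol_lt_one [MetricSpace X] [CompactSpace X]
    (f : X ≃ₜ X) (h : hpol (⇑f) < 1) :
    (∀ ε : ℝ, 0 < ε → ∃ k : ℕ, 1 ≤ k ∧
      ∀ x : X, ∃ j : ℕ, 1 ≤ j ∧ j ≤ k ∧ dist x ((⇑f)^[j] x) ≤ ε) ∧
    ∀ x : X, ∀ ε : ℝ, 0 < ε → ∃ j : ℕ, 1 ≤ j ∧ dist x ((⇑f)^[j] x) ≤ ε := by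
  have main : ∀ ε : ℝ, 0 < ε → ∃ k : ℕ, 1 ≤ k ∧
      ∀ x : X, ∃ j : ℕ, 1 ≤ j ∧ j ≤ k ∧ dist x ((⇑f)^[j] x) ≤ ε := by
    intro ε hε
    by_contra hcon
    push Not at hcon
    refine absurd h (not_lt.2 ?_)
    unfold hpol
    refine le_trans ?_ (le_iSup₂ (ε / 2) (by linarith : 0 < ε / 2))
    refine le_trans (limsup_const (f := (atTop : Filter ℕ)) (1 : ℝ≥0∞)).ge ?_
    refine limsup_le_limsup ?_
    filter_upwards [eventually_ge_atTop 2] with n hn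
    obtain ⟨x, hx⟩ := hcon n (by omega)
    have h1 := le_covNum f ε hε n x hx
    rw [ENNReal.one_le_ofReal]
    have hn' : (1 : ℝ) < n := by exact_mod_cast hn
    rw [one_le_div (Real.log_pos hn')]
    exact Real.log_le_log (by linarith) (by exact_mod_cast h1)
  refine ⟨main, fun x ε hε => ?_⟩
  obtain ⟨k, _, hk⟩ := main ε hε
  obtain ⟨j, h1, _, h2⟩ := hk x
  exact ⟨j, h1, h2⟩
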